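/- arXiv:2105.02690 — 6 statements merged into one kernel-verified Lean document; each statement's English description precedes it below -/
import Mathlib

section
/- Uniqueness of the elastic collision map (Theorem 1, converse direction): In E := EuclideanSpace ℝ (Fin n), let M, m > 0, γ := √(m/M), sinθ := 2γ/(1+γ²), let φ ∈ E with ‖φ‖ = 1 and P v := ⟪φ, v⟫ • φ. Suppose v₁, w₁, v₂, w₂ ∈ E satisfy: (i) v₂ − P v₂ = v₁ − P v₁ and w₂ − P w₂ = w₁ − P w₁ (the components orthogonal to the collision axis are unchanged); (ii) M • v₂ + m • w₂ = M • v₁ + m • w₁; (iii) M·‖v₂‖² + m·‖w₂‖² = M·‖v₁‖² + m·‖w₁‖²; and (iv) ⟪φ, v₂⟫ ≠ ⟪φ, v₁⟫. Then v₂ = v₁ + γ·sinθ • P(w₁ − v₁) and w₂ = w₁ − (sinθ/γ) • P(w₁ − v₁). -/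
open scoped RealInnerProductSpace

/-- The energy of a velocity changed by `a` along a unit vector. -/
theorem norm_add_smul_unit_sq {E : Type*} [NormedAddCommGroup E] [InnerProductSpace ℝ E]
    {φ : E} (hφ : ‖φ‖ = 1) (v : E) (a : ℝ) :
    ‖v + a • φ‖ ^ 2 = ‖v‖ ^ 2 + 2 * a * ⟪φ, v⟫ + a ^ 2 := by
  rw [norm_add_sq_real, norm_smul, hφ, real_inner_smul_right, real_inner_comm, mul_one,
    Real.norm_eq_abs, sq_abs]
  ring

/-- A nontrivial pair of velocity changes `a`, `b` conserving momentum and energy on a line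
is determined by the relative velocity `y - x`. -/
theorem elastic_velocity_changes {M m a b x y : ℝ} (hM : 0 < M) (hm : 0 < m) (ha : a ≠ 0)
    (hmom : M * a + m * b = 0) (hen : M * (2 * a * x + a ^ 2) + m * (2 * b * y + b ^ 2) = 0) :
    a = 2 * m / (M + m) * (y - x) ∧ b = -(2 * M / (M + m) * (y - x)) := by
  have hMm : M + m ≠ 0 := by positivity
  have hrel : a - b = 2 * (y - x) := by
    apply mul_left_cancel₀ (mul_ne_zero hM.ne' ha)
    linear_combination hen - (2 * y + b) * hmom
  constructor
  · field_simp
    linear_combination hmom + m * hrel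
  · field_simp
    linear_combination hmom - M * hrel

/-- Uniqueness of the elastic collision map (Theorem 1, converse direction). -/
theorem collision_map_unique
    (n : ℕ) (M m : ℝ) (hM : 0 < M) (hm : 0 < m)
    (γ sinθ : ℝ)
    (hγ : γ = Real.sqrt (m / M))
    (hs : sinθ = 2 * γ / (1 + γ ^ 2))
    (φ : EuclideanSpace ℝ (Fin n)) (hφ : ‖φ‖ = 1)
    (P : EuclideanSpace ℝ (Fin n) → EuclideanSpace ℝ (Fin n))
    (hP : ∀ v, P v = ⟪φ, v⟫ • φ)
    (v₁ w₁ v₂ w₂ : EuclideanSpace ℝ (Fin n))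
    (horthv : v₂ - P v₂ = v₁ - P v₁)
    (horthw : w₂ - P w₂ = w₁ - P w₁)
    (hmom : M • v₂ + m • w₂ = M • v₁ + m • w₁)
    (hen : M * ‖v₂‖ ^ 2 + m * ‖w₂‖ ^ 2 = M * ‖v₁‖ ^ 2 + m * ‖w₁‖ ^ 2)
    (hne : ⟪φ, v₂⟫ ≠ ⟪φ, v₁⟫) :
    v₂ = v₁ + (γ * sinθ) • P (w₁ - v₁) ∧ w₂ = w₁ - (sinθ / γ) • P (w₁ - v₁) := by
  have hγ0 : 0 < γ := hγ ▸ Real.sqrt_pos.2 (div_pos hm hM)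
  have hγsq : γ ^ 2 = m / M := by rw [hγ, Real.sq_sqrt (div_pos hm hM).le]
  have hv_coeff : γ * sinθ = 2 * m / (M + m) := by
    calc γ * sinθ = 2 * γ ^ 2 / (1 + γ ^ 2) := by rw [hs]; ring
      _ = 2 * m / (M + m) := by rw [hγsq]; field_simp
  have hw_coeff : sinθ / γ = 2 * M / (M + m) := by
    calc sinθ / γ = 2 / (1 + γ ^ 2) := by rw [hs]; field_simp
      _ = 2 * M / (M + m) := by rw [hγsq]; field_simp
  have hφφ : ⟪φ, φ⟫ = 1 := by rw [real_inner_self_eq_norm_sq, hφ, one_pow]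
  obtain ⟨a, rfl⟩ : ∃ a : ℝ, v₂ = v₁ + a • φ := by
    refine ⟨⟪φ, v₂⟫ - ⟪φ, v₁⟫, ?_⟩
    rw [hP, hP] at horthv
    linear_combination (norm := module) horthv
  obtain ⟨b, rfl⟩ : ∃ b : ℝ, w₂ = w₁ + b • φ := by
    refine ⟨⟪φ, w₂⟫ - ⟪φ, w₁⟫, ?_⟩
    rw [hP, hP] at horthw
    linear_combination (norm := module) horthw
  have ha : a ≠ 0 := by
    rintro rfl
    simp at hne
  have hline : M * a + m * b = 0 := by
    have h := congrArg (fun u => ⟪φ, u⟫) hmom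
    simp only [inner_add_right, real_inner_smul_right, hφφ] at h
    linear_combination h
  rw [norm_add_smul_unit_sq hφ, norm_add_smul_unit_sq hφ] at hen
  obtain ⟨ha_eq, hb_eq⟩ := elastic_velocity_changes (x := ⟪φ, v₁⟫) (y := ⟪φ, w₁⟫)
    hM hm ha hline (by linear_combination hen)
  rw [hP, inner_sub_right, hv_coeff, hw_coeff, smul_smul, smul_smul, ← ha_eq, sub_eq_add_neg w₁,
    ← neg_smul, ← hb_eq]
  exact ⟨rfl, rfl⟩
end

section
/- Eigenvector representation of the collision (Theorem 2): In E := EuclideanSpace ℝ (Fin n), let M, m > 0, γ := √(m/M), sinθ := 2γ/(1+γ²), let φ ∈ E with ‖φ‖ = 1, P v := ⟪φ, v⟫ • φ, v₁, w₁ ∈ E, v₂ := v₁ + γ·sinθ • P(w₁ − v₁), w₂ := w₁ − (sinθ/γ) • P(w₁ − v₁), Φ := sinθ • ((v₁ − w₁) − P(v₁ − w₁)). Define a := (1/(M+m)) • (M • v₁ + m • w₁), b := (1/(1+γ²)) • (w₁ − v₁), and b⊥ := b + (1/γ) • Φ. Then v₁ = a − γ² • b, w₁ = a + b, v₂ = a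 + γ² • b⊥, w₂ = a − b⊥, and ‖b⊥‖ = ‖b‖. -/
open scoped RealInnerProductSpace

/-- Eigenvector representation of the collision (Theorem 2). -/
theorem eigenvector_representation
    (n : ℕ) (M m : ℝ) (hM : 0 < M) (hm : 0 < m)
    (γ sinθ : ℝ)
    (hγ : γ = Real.sqrt (m / M))
    (hs : sinθ = 2 * γ / (1 + γ ^ 2))
    (φ : EuclideanSpace ℝ (Fin n)) (hφ : ‖φ‖ = 1)
    (P : EuclideanSpace ℝ (Fin n) → EuclideanSpace ℝ (Fin n))
    (hP : ∀ v, P v = ⟪φ, v⟫ • φ)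
    (v₁ w₁ v₂ w₂ Φ a b bperp : EuclideanSpace ℝ (Fin n))
    (hv₂ : v₂ = v₁ + (γ * sinθ) • P (w₁ - v₁))
    (hw₂ : w₂ = w₁ - (sinθ / γ) • P (w₁ - v₁))
    (hΦ : Φ = sinθ • ((v₁ - w₁) - P (v₁ - w₁)))
    (ha : a = (1 / (M + m)) • (M • v₁ + m • w₁))
    (hb : b = (1 / (1 + γ ^ 2)) • (w₁ - v₁))
    (hbp : bperp = b + (1 / γ) • Φ) :
    v₁ = a - γ ^ 2 • b ∧ w₁ = a + b ∧ v₂ = a + γ ^ 2 • bperp ∧ w₂ = a - bperp ∧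
      ‖bperp‖ = ‖b‖ := by
  have hγ0 : 0 < γ := hγ ▸ Real.sqrt_pos.mpr (div_pos hm hM)
  have hm' : m = γ ^ 2 * M := by
    rw [hγ, Real.sq_sqrt (div_pos hm hM).le, div_mul_cancel₀ m hM.ne']
  have hk : (1 + γ ^ 2) ≠ 0 := by positivity
  have ha' : a = v₁ + γ ^ 2 • b := by
    rw [ha, hb, hm']
    match_scalars <;> field_simp <;> ring
  have hw₁ : w₁ = a + b := by
    rw [ha', hb]
    match_scalars <;> field_simp <;> ring
  have hbp' : bperp = (2 / (1 + γ ^ 2)) • P (w₁ - v₁) - b := by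
    have hneg : P (v₁ - w₁) = -P (w₁ - v₁) := by
      rw [hP, hP, ← neg_sub w₁ v₁, inner_neg_right, neg_smul]
    rw [hbp, hΦ, hneg, hb, hs]
    match_scalars <;> field_simp <;> ring
  have hrefl : bperp = (ℝ ∙ φ).reflection b := by
    rw [Submodule.reflection_apply, Submodule.starProjection_unit_singleton ℝ hφ, hbp', hb, hP,
      inner_smul_right]
    module
  refine ⟨by rw [ha', add_sub_cancel_right], hw₁, ?_, ?_, ?_⟩
  · rw [hv₂, hbp', ha', hs]
    match_scalars <;> field_simp <;> ring
  · have hcoef : sinθ / γ = 2 / (1 + γ ^ 2) := by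
      rw [hs]
      field_simp
    rw [hw₂, hbp', hcoef, sub_sub_eq_add_sub, ← hw₁]
  · rw [hrefl, LinearIsometryEquiv.norm_map]
end

section
/- Weighted Nelson-measure decomposition of the conserved energy (Theorem 3, the paper's main result): In E := EuclideanSpace ℝ (Fin n), let M, m > 0, γ := √(m/M), sinθ := 2γ/(1+γ²), let φ ∈ E with ‖φ‖ = 1, P v := ⟪φ, v⟫ • φ, v₁, w₁ ∈ E, v₂ := v₁ + γ·sinθ • P(w₁ − v₁), w₂ := w₁ − (sinθ/γ) • P(w₁ − v₁). Then ‖v₁‖² + γ²·‖w₁‖² = ‖(v₂ + v₁)/2‖² + (1/γ²)·‖(v₂ − v₁)/2‖² + γ²·‖(w₂ + w₁)/2‖² + γ⁴·‖(w₂ − w₁)/2‖². Equivalently, with H := (M/2)‖v₁‖² + (m/2)‖w₁‖², the right-hand side multiplied by M/2 equals H. -/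
open scoped RealInnerProductSpace

/-- The squared norm of a vector shifted along a unit direction. -/
theorem norm_add_smul_sq_of_norm_eq_one {E : Type*} [NormedAddCommGroup E]
    [InnerProductSpace ℝ E] {u : E} (hu : ‖u‖ = 1) (x : E) (c : ℝ) :
    ‖x + c • u‖ ^ 2 = ‖x‖ ^ 2 + 2 * c * ⟪u, x⟫ + c ^ 2 := by
  rw [norm_add_sq_real, inner_smul_right, real_inner_comm, norm_smul, hu, mul_one,
    Real.norm_eq_abs, sq_abs]
  ring

/-- The squared norm of a multiple of a unit vector. -/
theorem norm_smul_sq_of_norm_eq_one {E : Type*} [NormedAddCommGroup E]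
    [InnerProductSpace ℝ E] {u : E} (hu : ‖u‖ = 1) (c : ℝ) : ‖c • u‖ ^ 2 = c ^ 2 := by
  rw [norm_smul, hu, mul_one, Real.norm_eq_abs, sq_abs]

/-- Weighted Nelson-measure decomposition of the conserved energy (Theorem 3). -/
theorem weighted_nelson_energy_decomposition
    (n : ℕ) (M m : ℝ) (hM : 0 < M) (hm : 0 < m)
    (γ sinθ : ℝ)
    (hγ : γ = Real.sqrt (m / M))
    (hs : sinθ = 2 * γ / (1 + γ ^ 2))
    (φ : EuclideanSpace ℝ (Fin n)) (hφ : ‖φ‖ = 1)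
    (P : EuclideanSpace ℝ (Fin n) → EuclideanSpace ℝ (Fin n))
    (hP : ∀ v, P v = ⟪φ, v⟫ • φ)
    (v₁ w₁ v₂ w₂ : EuclideanSpace ℝ (Fin n))
    (hv₂ : v₂ = v₁ + (γ * sinθ) • P (w₁ - v₁))
    (hw₂ : w₂ = w₁ - (sinθ / γ) • P (w₁ - v₁)) :
    ‖v₁‖ ^ 2 + γ ^ 2 * ‖w₁‖ ^ 2 =
      ‖(2:ℝ)⁻¹ • (v₂ + v₁)‖ ^ 2 + (1 / γ ^ 2) * ‖(2:ℝ)⁻¹ • (v₂ - v₁)‖ ^ 2 +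
        γ ^ 2 * ‖(2:ℝ)⁻¹ • (w₂ + w₁)‖ ^ 2 + γ ^ 4 * ‖(2:ℝ)⁻¹ • (w₂ - w₁)‖ ^ 2 ∧
    M / 2 * (‖(2:ℝ)⁻¹ • (v₂ + v₁)‖ ^ 2 + (1 / γ ^ 2) * ‖(2:ℝ)⁻¹ • (v₂ - v₁)‖ ^ 2 +
        γ ^ 2 * ‖(2:ℝ)⁻¹ • (w₂ + w₁)‖ ^ 2 + γ ^ 4 * ‖(2:ℝ)⁻¹ • (w₂ - w₁)‖ ^ 2) =
      M / 2 * ‖v₁‖ ^ 2 + m / 2 * ‖w₁‖ ^ 2 := by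
  have hγ_pos : 0 < γ := hγ ▸ Real.sqrt_pos.mpr (div_pos hm hM)
  have hγ_sq : M * γ ^ 2 = m := by
    rw [hγ, Real.sq_sqrt (div_pos hm hM).le]
    field_simp
  have hs_mul : sinθ * (1 + γ ^ 2) = 2 * γ := by
    rw [hs]
    field_simp
  set d := ⟪φ, w₁ - v₁⟫ with hd
  have hd_sub : d = ⟪φ, w₁⟫ - ⟪φ, v₁⟫ := by rw [hd, inner_sub_right]
  have hv_add : (2:ℝ)⁻¹ • (v₂ + v₁) = v₁ + (γ * sinθ * d / 2) • φ := by
    rw [hv₂, hP]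
    module
  have hv_sub : (2:ℝ)⁻¹ • (v₂ - v₁) = (γ * sinθ * d / 2) • φ := by
    rw [hv₂, hP]
    module
  have hw_add : (2:ℝ)⁻¹ • (w₂ + w₁) = w₁ + (-(sinθ / γ * d / 2)) • φ := by
    rw [hw₂, hP]
    module
  have hw_sub : (2:ℝ)⁻¹ • (w₂ - w₁) = (-(sinθ / γ * d / 2)) • φ := by
    rw [hw₂, hP]
    module
  have key : ‖v₁‖ ^ 2 + γ ^ 2 * ‖w₁‖ ^ 2 =
      ‖(2:ℝ)⁻¹ • (v₂ + v₁)‖ ^ 2 + (1 / γ ^ 2) * ‖(2:ℝ)⁻¹ • (v₂ - v₁)‖ ^ 2 +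
        γ ^ 2 * ‖(2:ℝ)⁻¹ • (w₂ + w₁)‖ ^ 2 + γ ^ 4 * ‖(2:ℝ)⁻¹ • (w₂ - w₁)‖ ^ 2 := by
    rw [hv_add, hv_sub, hw_add, hw_sub, norm_add_smul_sq_of_norm_eq_one hφ,
      norm_add_smul_sq_of_norm_eq_one hφ, norm_smul_sq_of_norm_eq_one hφ,
      norm_smul_sq_of_norm_eq_one hφ, eq_add_of_sub_eq' hd_sub.symm]
    field_simp
    linear_combination (-2 * d ^ 2 * sinθ) * hs_mul
  refine ⟨key, ?_⟩
  rw [← key, ← hγ_sq]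
  ring
end

section
/- Minkowski-type invariant relative to the average velocity (Theorem 9, first part): In E := EuclideanSpace ℝ (Fin n), let M, m > 0, γ := √(m/M), sinθ := 2γ/(1+γ²), let φ ∈ E with ‖φ‖ = 1, P v := ⟪φ, v⟫ • φ, v₁, w₁ ∈ E, v₂ := v₁ + γ·sinθ • P(w₁ − v₁), w₂ := w₁ − (sinθ/γ) • P(w₁ − v₁), and a := (1/(M+m)) • (M • v₁ + m • w₁). Then ‖w₂ − a‖² − ‖v₂ − a‖² = ‖w₁ − a‖² − ‖v₁ − a‖². -/
open scoped RealInnerProductSpace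

/-- Reflection in the hyperplane orthogonal to a unit vector preserves the norm. -/
theorem norm_sub_two_inner_smul {E : Type*} [NormedAddCommGroup E] [InnerProductSpace ℝ E]
    {e : E} (he : ‖e‖ = 1) (u : E) : ‖u - (2 * ⟪e, u⟫) • e‖ = ‖u‖ := by
  rw [← sq_eq_sq₀ (norm_nonneg _) (norm_nonneg _), norm_sub_sq_real, norm_smul, inner_smul_right,
    he, mul_one, Real.norm_eq_abs, sq_abs, real_inner_comm]
  ring

/-- Minkowski-type invariant relative to the average velocity (Theorem 9, first part). -/
theorem minkowski_type_invariant
    (n : ℕ) (M m : ℝ) (hM : 0 < M) (hm : 0 < m)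
    (γ sinθ : ℝ)
    (hγ : γ = Real.sqrt (m / M))
    (hs : sinθ = 2 * γ / (1 + γ ^ 2))
    (φ : EuclideanSpace ℝ (Fin n)) (hφ : ‖φ‖ = 1)
    (P : EuclideanSpace ℝ (Fin n) → EuclideanSpace ℝ (Fin n))
    (hP : ∀ v, P v = ⟪φ, v⟫ • φ)
    (v₁ w₁ v₂ w₂ a : EuclideanSpace ℝ (Fin n))
    (hv₂ : v₂ = v₁ + (γ * sinθ) • P (w₁ - v₁))
    (hw₂ : w₂ = w₁ - (sinθ / γ) • P (w₁ - v₁))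
    (ha : a = (1 / (M + m)) • (M • v₁ + m • w₁)) :
    ‖w₂ - a‖ ^ 2 - ‖v₂ - a‖ ^ 2 = ‖w₁ - a‖ ^ 2 - ‖v₁ - a‖ ^ 2 := by
  have hMm : M + m ≠ 0 := by positivity
  have hγ_pos : 0 < γ := hγ ▸ Real.sqrt_pos.mpr (div_pos hm hM)
  have hγ_sq : γ ^ 2 = m / M := hγ ▸ Real.sq_sqrt (div_pos hm hM).le
  have h_mul : γ * sinθ = 2 * (m / (M + m)) := by
    have h : γ * sinθ = 2 * γ ^ 2 / (1 + γ ^ 2) := by rw [hs]; ring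
    rw [h, hγ_sq]
    field_simp
  have h_div : sinθ / γ = 2 * (M / (M + m)) := by
    have h : sinθ / γ = 2 / (1 + γ ^ 2) := by rw [hs]; field_simp
    rw [h, hγ_sq]
    field_simp
  have hw₁a : w₁ - a = (M / (M + m)) • (w₁ - v₁) := by
    rw [ha]
    match_scalars <;> field_simp <;> ring
  have hv₁a : v₁ - a = (-(m / (M + m))) • (w₁ - v₁) := by
    rw [ha]
    match_scalars <;> field_simp <;> ring
  have hw₂a : w₂ - a = (M / (M + m)) • (w₁ - v₁ - (2 * ⟪φ, w₁ - v₁⟫) • φ) := by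
    rw [hw₂, h_div, hP, sub_right_comm, hw₁a]
    module
  have hv₂a : v₂ - a = (-(m / (M + m))) • (w₁ - v₁ - (2 * ⟪φ, w₁ - v₁⟫) • φ) := by
    rw [hv₂, h_mul, hP, add_sub_right_comm, hv₁a]
    module
  rw [hw₂a, hv₂a, hw₁a, hv₁a]
  simp only [norm_smul, norm_sub_two_inner_smul hφ]
end

section
/- Value of the Minkowski-type invariant (identities in the proof of Theorem 9): In the setting of the elastic collision model, with a := (1/(M+m)) • (M • v₁ + m • w₁), b := (1/(1+γ²)) • (w₁ − v₁), Φ := sinθ • ((v₁ − w₁) − P(v₁ − w₁)) and b⊥ := b + (1/γ) • Φ, one has ‖w₁ − a‖² − ‖v₁ − a‖² = (1 − γ⁴)·‖b‖² and ‖w₂ − a‖² − ‖v₂ − a‖² = (1 − γ⁴)·‖b⊥‖², where v₂ := v₁ + γ·sinθ • P(w₁ − v₁) and w₂ := w₁ − (sinθ/γ) • P(w₁ − v₁). -/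
open scoped RealInnerProductSpace

/-- If two vectors are `c` and `-γ² c`, the difference of their squared norms is
`(1 - γ⁴) ‖c‖²`. -/
theorem norm_sq_sub_norm_sq_of_eq_smul {E : Type*} [SeminormedAddCommGroup E] [NormedSpace ℝ E]
    {γ : ℝ} {x y c : E} (hx : x = c) (hy : y = -(γ ^ 2 • c)) :
    ‖x‖ ^ 2 - ‖y‖ ^ 2 = (1 - γ ^ 4) * ‖c‖ ^ 2 := by
  rw [hx, hy, norm_neg, norm_smul, mul_pow, Real.norm_eq_abs, sq_abs]
  ring

/-- Value of the Minkowski-type invariant (identities in the proof of Theorem 9). -/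
theorem minkowski_invariant_value
    (n : ℕ) (M m : ℝ) (hM : 0 < M) (hm : 0 < m)
    (γ sinθ : ℝ)
    (hγ : γ = Real.sqrt (m / M))
    (hs : sinθ = 2 * γ / (1 + γ ^ 2))
    (φ : EuclideanSpace ℝ (Fin n)) (hφ : ‖φ‖ = 1)
    (P : EuclideanSpace ℝ (Fin n) → EuclideanSpace ℝ (Fin n))
    (hP : ∀ v, P v = ⟪φ, v⟫ • φ)
    (v₁ w₁ v₂ w₂ a b Φ bperp : EuclideanSpace ℝ (Fin n))
    (hv₂ : v₂ = v₁ + (γ * sinθ) • P (w₁ - v₁))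
    (hw₂ : w₂ = w₁ - (sinθ / γ) • P (w₁ - v₁))
    (ha : a = (1 / (M + m)) • (M • v₁ + m • w₁))
    (hb : b = (1 / (1 + γ ^ 2)) • (w₁ - v₁))
    (hΦ : Φ = sinθ • ((v₁ - w₁) - P (v₁ - w₁)))
    (hbp : bperp = b + (1 / γ) • Φ) :
    ‖w₁ - a‖ ^ 2 - ‖v₁ - a‖ ^ 2 = (1 - γ ^ 4) * ‖b‖ ^ 2 ∧
      ‖w₂ - a‖ ^ 2 - ‖v₂ - a‖ ^ 2 = (1 - γ ^ 4) * ‖bperp‖ ^ 2 := by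
  have hγ0 : γ ≠ 0 := by
    rw [hγ]
    exact (Real.sqrt_pos.mpr (div_pos hm hM)).ne'
  have hmass : m = γ ^ 2 * M := by
    rw [hγ, Real.sq_sqrt (div_pos hm hM).le]
    field_simp
  have hsum : 1 + γ ^ 2 ≠ 0 := by positivity
  have hM0 : M ≠ 0 := hM.ne'
  have hmean : a = (1 / (1 + γ ^ 2)) • (v₁ + γ ^ 2 • w₁) := by
    have hMm : M + γ ^ 2 * M ≠ 0 := by positivity
    rw [ha, hmass]
    match_scalars <;> field_simp
  have hPneg : P (v₁ - w₁) = -P (w₁ - v₁) := by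
    rw [hP, hP, ← neg_sub w₁ v₁, inner_neg_right, neg_smul]
  constructor
  · apply norm_sq_sub_norm_sq_of_eq_smul
    · rw [hmean, hb]
      match_scalars <;> field_simp <;> ring
    · rw [hmean, hb]
      match_scalars <;> field_simp <;> ring
  · rw [← norm_neg bperp]
    apply norm_sq_sub_norm_sq_of_eq_smul
    · rw [hw₂, hbp, hΦ, hPneg, hmean, hb, hs]
      match_scalars <;> field_simp <;> ring
    · rw [hv₂, hbp, hΦ, hPneg, hmean, hb, hs]
      match_scalars <;> field_simp <;> ring
end

section
/- Energy change of the main particle (identity in the proof of Theorem 9): In the elastic collision setting, with a := (1/(M+m)) • (M • v₁ + m • w₁), b := (1/(1+γ²)) • (w₁ − v₁), Φ := sinθ • ((v₁ − w₁) − P(v₁ − w₁)), b⊥ := b + (1/γ) • Φ, and v₂ := v₁ + γ·sinθ • P(w₁ − v₁), one has ‖v₂‖² − ‖v₁‖² = 2·γ²·⟪a, b + b⊥⟫. Hence the main particle neither gains nor loses energy if and only if ⟪a, b + b⊥⟫ = 0. -/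
open scoped RealInnerProductSpace

/-- Energy change of the main particle (identity in the proof of Theorem 9). -/
theorem main_particle_energy_change
    (n : ℕ) (M m : ℝ) (hM : 0 < M) (hm : 0 < m)
    (γ sinθ : ℝ)
    (hγ : γ = Real.sqrt (m / M))
    (hs : sinθ = 2 * γ / (1 + γ ^ 2))
    (φ : EuclideanSpace ℝ (Fin n)) (hφ : ‖φ‖ = 1)
    (P : EuclideanSpace ℝ (Fin n) → EuclideanSpace ℝ (Fin n))
    (hP : ∀ v, P v = ⟪φ, v⟫ • φ)
    (v₁ w₁ v₂ a b Φ bperp : EuclideanSpace ℝ (Fin n))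
    (hv₂ : v₂ = v₁ + (γ * sinθ) • P (w₁ - v₁))
    (ha : a = (1 / (M + m)) • (M • v₁ + m • w₁))
    (hb : b = (1 / (1 + γ ^ 2)) • (w₁ - v₁))
    (hΦ : Φ = sinθ • ((v₁ - w₁) - P (v₁ - w₁)))
    (hbp : bperp = b + (1 / γ) • Φ) :
    ‖v₂‖ ^ 2 - ‖v₁‖ ^ 2 = 2 * γ ^ 2 * ⟪a, b + bperp⟫ ∧
      (‖v₂‖ ^ 2 = ‖v₁‖ ^ 2 ↔ ⟪a, b + bperp⟫ = 0) := by
  have hγ_pos : 0 < γ := hγ ▸ Real.sqrt_pos.mpr (div_pos hm hM)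
  have hm_eq : m = γ ^ 2 * M := by
    rw [hγ, Real.sq_sqrt (div_pos hm hM).le]
    field_simp
  have hk : (1 + γ ^ 2) ≠ 0 := by positivity
  have ha' : a = v₁ + (γ ^ 2 / (1 + γ ^ 2)) • (w₁ - v₁) := by
    rw [ha, hm_eq]
    have hMk : M + γ ^ 2 * M ≠ 0 := by positivity
    match_scalars <;> field_simp <;> ring
  have hsum : b + bperp = (2 / (1 + γ ^ 2)) • P (w₁ - v₁) := by
    have hneg : P (v₁ - w₁) = -P (w₁ - v₁) := by
      rw [hP, hP, ← neg_smul, ← inner_neg_right, neg_sub]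
    rw [hbp, hΦ, hneg, hb, hs]
    match_scalars <;> field_simp <;> ring
  have hφφ : ⟪φ, φ⟫ = 1 := by rw [real_inner_self_eq_norm_sq, hφ, one_pow]
  have henergy : ‖v₂‖ ^ 2 - ‖v₁‖ ^ 2 = 2 * γ ^ 2 * ⟪a, b + bperp⟫ := by
    rw [hsum, ha', hv₂, hP, hs, ← real_inner_self_eq_norm_sq, ← real_inner_self_eq_norm_sq]
    simp only [inner_add_left, inner_add_right, inner_sub_left, inner_sub_right,
      real_inner_smul_left, real_inner_smul_right, hφφ,
      real_inner_comm φ v₁, real_inner_comm φ w₁]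
    field_simp
    ring
  refine ⟨henergy, ?_⟩
  rw [← sub_eq_zero, henergy, mul_eq_zero, or_iff_right (by positivity)]
end
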